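/- Let G be a graph with maximum degree Δ(G) ≥ 1. Then Γ⃗_LD(G) ≥ γ_LD(G)/(⌈log₂ Δ(G)⌉ + 1). -/

import Mathlib

open SimpleGraph

/-- `S` is a locating-dominating set of the undirected graph `G`. -/
def IsLDSet {V : Type*} (G : SimpleGraph V) (S : Set V) : Prop :=
  (∀ u ∉ S, (G.neighborSet u ∩ S).Nonempty) ∧
    ∀ u ∉ S, ∀ v ∉ S, u ≠ v → G.neighborSet u ∩ S ≠ G.neighborSet v ∩ S

/-- The location-domination number of the undirected graph `G`. -/
noncomputable def gammaLD {V : Type*} (G : SimpleGraph V) : ℕ :=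
  sInf {n | ∃ S : Set V, IsLDSet G S ∧ S.ncard = n}

/-- `D` is an orientation of `G`: every arc of `D` is an edge of `G`, and every
edge of `G` is given exactly one of its two possible directions. -/
def IsOrientation {V : Type*} (G : SimpleGraph V) (D : V → V → Prop) : Prop :=
  (∀ u v, D u v → G.Adj u v) ∧ ∀ u v, G.Adj u v → (D u v ↔ ¬ D v u)

/-- `S` is a locating-dominating set of the directed graph `D`
(arcs given as a relation: `D w u` means there is an arc from `w` to `u`). -/
def IsDirLDSet {V : Type*} (D : V → V → Prop) (S : Set V) : Prop :=
  (∀ u ∉ S, ({w | D w u} ∩ S).Nonempty) ∧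
    ∀ u ∉ S, ∀ v ∉ S, u ≠ v → {w | D w u} ∩ S ≠ {w | D w v} ∩ S

/-- The location-domination number of a directed graph. -/
noncomputable def gammaLDdir {V : Type*} (D : V → V → Prop) : ℕ :=
  sInf {n | ∃ S : Set V, IsDirLDSet D S ∧ S.ncard = n}

/-- The lower directed location-domination number of `G`:
minimum of `gammaLDdir D` over all orientations `D` of `G`. -/
noncomputable def lowerDirLD {V : Type*} (G : SimpleGraph V) : ℕ :=
  sInf {n | ∃ D : V → V → Prop, IsOrientation G D ∧ gammaLDdir D = n}

/-- The upper directed location-domination number of `G`: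
maximum of `gammaLDdir D` over all orientations `D` of `G`. -/
noncomputable def upperDirLD {V : Type*} (G : SimpleGraph V) : ℕ :=
  sSup {n | ∃ D : V → V → Prop, IsOrientation G D ∧ gammaLDdir D = n}

lemma isDirLDSet_univ {V : Type*} (D : V → V → Prop) : IsDirLDSet D Set.univ :=
  ⟨fun _ hu => (hu trivial).elim, fun _ hu => (hu trivial).elim⟩

lemma gammaLDdir_le_card {V : Type*} (D : V → V → Prop) :
    gammaLDdir D ≤ (Set.univ : Set V).ncard :=
  Nat.sInf_le ⟨Set.univ, isDirLDSet_univ D, rfl⟩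

lemma exists_isDirLDSet_ncard_eq {V : Type*} (D : V → V → Prop) :
    ∃ S : Set V, IsDirLDSet D S ∧ S.ncard = gammaLDdir D :=
  Nat.sInf_mem (s := {n | ∃ S : Set V, IsDirLDSet D S ∧ S.ncard = n})
    ⟨_, Set.univ, isDirLDSet_univ D, rfl⟩

lemma gammaLDdir_le_upperDirLD {V : Type*} {G : SimpleGraph V} {D : V → V → Prop}
    (hD : IsOrientation G D) : gammaLDdir D ≤ upperDirLD G := by
  refine le_csSup ⟨(Set.univ : Set V).ncard, ?_⟩ ⟨D, hD, rfl⟩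
  rintro _ ⟨D, -, rfl⟩
  exact gammaLDdir_le_card D

/-- If the fibres of `b` have at most two elements, some dominating set with at most
`upperDirLD G` vertices locates every pair of vertices lying in a common fibre. -/
lemma exists_dominating_locating_fibres {V : Type*} [Finite V] (G : SimpleGraph V) (b : V → ℕ)
    (hb : ∀ u v w, b u = b v → b w = b v → u ≠ v → w = u ∨ w = v) :
    ∃ X : Set V, X.ncard ≤ upperDirLD G ∧ (∀ u ∉ X, (G.neighborSet u ∩ X).Nonempty) ∧
      ∀ u ∉ X, ∀ v ∉ X, u ≠ v → b u = b v → G.neighborSet u ∩ X ≠ G.neighborSet v ∩ X := by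
  obtain ⟨e, he⟩ := exists_injective_nat V
  let D : V → V → Prop := fun u v => G.Adj u v ∧ (b u < b v ∨ b u = b v ∧ e u < e v)
  have hD : IsOrientation G D := by
    refine ⟨fun u v h => h.1, fun u v h => ?_⟩
    have hne : e u ≠ e v := fun h' => h.ne (he h')
    simp only [D, h, h.symm, true_and]
    omega
  obtain ⟨X, hX, hcard⟩ := exists_isDirLDSet_ncard_eq D
  refine ⟨X, hcard.trans_le (gammaLDdir_le_upperDirLD hD), fun u hu => ?_, ?_⟩
  · obtain ⟨w, hw, hwX⟩ := hX.1 u hu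
    exact ⟨w, hw.1.symm, hwX⟩
  · intro u hu v hv huv hbuv heq
    refine hX.2 u hu v hv huv ?_
    ext w
    simp only [Set.mem_inter_iff, Set.mem_ofPred_eq, D]
    refine and_congr_left fun hw => ?_
    have hbw : b w ≠ b v := by
      intro h
      rcases hb u v w hbuv h huv with rfl | rfl
      exacts [hu hw, hv hw]
    have hadj := Set.ext_iff.1 heq w
    simp only [Set.mem_inter_iff, SimpleGraph.mem_neighborSet, hw, and_true] at hadj
    rw [G.adj_comm w u, G.adj_comm w v, hadj, hbuv]
    simp [hbw]

/-- The vertices outside `S` having the same neighbours in `S` as `u`. -/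
def unlocatedClass {V : Type*} (G : SimpleGraph V) (S : Set V) (u : V) : Set V :=
  {v | v ∉ S ∧ G.neighborSet v ∩ S = G.neighborSet u ∩ S}

lemma exists_halving_set {V : Type*} [Finite V] (G : SimpleGraph V) (S : Set V) (m : ℕ)
    (hS : ∀ u ∉ S, (unlocatedClass G S u).ncard ≤ 2 * m) :
    ∃ X : Set V, X.ncard ≤ upperDirLD G ∧
      ∀ u ∉ S ∪ X, (unlocatedClass G (S ∪ X) u).ncard ≤ m := by
  obtain ⟨e, he⟩ := exists_injective_nat V
  let c : V → Set V × Prop := fun u => (G.neighborSet u ∩ S, u ∈ S)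
  let f : V → ℕ := fun u => {v | c v = c u ∧ e v < e u}.ncard
  have f_lt : ∀ u v, c u = c v → e u < e v → f u < f v := by
    intro u v hc huv
    refine Set.ncard_lt_ncard ⟨fun w hw => ⟨hw.1.trans hc, hw.2.trans huv⟩, fun h => ?_⟩
    exact lt_irrefl _ (h (show u ∈ {w | c w = c v ∧ e w < e v} from ⟨hc, huv⟩)).2
  have f_inj : ∀ u v, c u = c v → f u = f v → u = v := by
    intro u v hc hf
    by_contra hne
    rcases lt_or_gt_of_ne (fun h => hne (he h) : e u ≠ e v) with h | h
    · exact (f_lt u v hc h).ne hf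
    · exact (f_lt v u hc.symm h).ne hf.symm
  have f_bound : ∀ u ∉ S, f u < 2 * m := by
    intro u hu
    refine lt_of_lt_of_le (Set.ncard_lt_ncard ⟨fun w hw => ?_, fun h => ?_⟩) (hS u hu)
    · have h := Prod.ext_iff.1 hw.1
      exact ⟨fun hwS => hu (Eq.mp h.2 hwS), h.1⟩
    · exact lt_irrefl _ (h (show u ∈ unlocatedClass G S u from ⟨hu, rfl⟩)).2
  obtain ⟨g, hg⟩ := exists_injective_nat ((Set V × Prop) × ℕ)
  obtain ⟨X, hXcard, -, hX⟩ :=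
    exists_dominating_locating_fibres G (fun u => g (c u, f u / 2)) (by
      intro u v w huv hwv hne
      have h₁ := Prod.ext_iff.1 (hg huv)
      have h₂ := Prod.ext_iff.1 (hg hwv)
      dsimp only at h₁ h₂
      by_contra! hw
      have h₃ : f u ≠ f v := fun h => hne (f_inj u v h₁.1 h)
      have h₄ : f w ≠ f v := fun h => hw.2 (f_inj w v h₂.1 h)
      have h₅ : f w ≠ f u := fun h => hw.1 (f_inj w u (h₂.1.trans h₁.1.symm) h)
      omega)
  refine ⟨X, hXcard, fun u hu => ?_⟩
  have hmaps : ∀ v ∈ unlocatedClass G (S ∪ X) u, f v / 2 ∈ Set.Iio m := by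
    intro v hv
    have := f_bound v fun h => hv.1 (Or.inl h)
    simp only [Set.mem_Iio]
    omega
  have hinj : Set.InjOn (fun v => f v / 2) (unlocatedClass G (S ∪ X) u) := by
    intro v hv w hw hvw
    by_contra hne
    have heq := hv.2.trans hw.2.symm
    have hrestr : ∀ T ⊆ S ∪ X, G.neighborSet v ∩ T = G.neighborSet w ∩ T := by
      intro T hT
      rw [← Set.inter_eq_self_of_subset_right hT, ← Set.inter_assoc, heq, Set.inter_assoc]
    have hc : c v = c w := Prod.ext (hrestr S Set.subset_union_left)
      (propext (iff_of_false (fun h => hv.1 (Or.inl h)) fun h => hw.1 (Or.inl h)))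
    refine hX v (fun h => hv.1 (Or.inr h)) w (fun h => hw.1 (Or.inr h)) hne ?_
      (hrestr X Set.subset_union_right)
    exact congrArg g (Prod.ext hc hvw)
  simpa [Set.ncard_eq_toFinset_card'] using
    Set.ncard_le_ncard_of_injOn _ hmaps hinj (Set.finite_Iio m)

lemma gammaLD_le_of_dominating {V : Type*} [Finite V] (G : SimpleGraph V) (k : ℕ) :
    ∀ S : Set V, (∀ u ∉ S, (G.neighborSet u ∩ S).Nonempty) →
      (∀ u ∉ S, (unlocatedClass G S u).ncard ≤ 2 ^ k) →
      gammaLD G ≤ S.ncard + k * upperDirLD G := by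
  induction k with
  | zero =>
    intro S hdom hS
    have hLD : IsLDSet G S := by
      refine ⟨hdom, fun u hu v hv huv heq => huv ?_⟩
      exact (Set.ncard_le_one (Set.toFinite _)).1 (hS u hu) u ⟨hu, rfl⟩ v ⟨hv, heq.symm⟩
    have hle : gammaLD G ≤ S.ncard := Nat.sInf_le ⟨S, hLD, rfl⟩
    exact hle.trans (Nat.le_add_right _ _)
  | succ k ih =>
    intro S hdom hS
    obtain ⟨X, hX, hclass⟩ := exists_halving_set G S (2 ^ k) (by simpa [pow_succ'] using hS)
    have h := ih (S ∪ X) (fun u hu => (hdom u fun h => hu (Or.inl h)).mono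
      (Set.inter_subset_inter_right _ Set.subset_union_left)) hclass
    have := Set.ncard_union_le S X
    rw [Nat.succ_mul]
    omega

lemma gammaLD_le_clog_maxDegree_mul {V : Type*} [Fintype V] (G : SimpleGraph V)
    [DecidableRel G.Adj] :
    gammaLD G ≤ (Nat.clog 2 G.maxDegree + 1) * upperDirLD G := by
  obtain ⟨e, he⟩ := exists_injective_nat V
  obtain ⟨S, hcard, hdom, -⟩ := exists_dominating_locating_fibres G e
    fun u v w huv _ hne => (hne (he huv)).elim
  refine (gammaLD_le_of_dominating G (Nat.clog 2 G.maxDegree) S hdom fun u hu => ?_).trans ?_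
  · obtain ⟨s, hus, hs⟩ := hdom u hu
    have hsub : unlocatedClass G S u ⊆ G.neighborSet s := by
      intro v hv
      have hsv : s ∈ G.neighborSet v ∩ S := hv.2 ▸ ⟨hus, hs⟩
      exact hsv.1.symm
    calc (unlocatedClass G S u).ncard ≤ (G.neighborSet s).ncard := Set.ncard_le_ncard hsub
      _ = G.degree s := by
        rw [Set.ncard_eq_toFinset_card', ← SimpleGraph.card_neighborFinset_eq_degree]; rfl
      _ ≤ G.maxDegree := G.degree_le_maxDegree s
      _ ≤ _ := Nat.le_pow_clog one_lt_two _
  · rw [Nat.succ_mul]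
    omega

/-- if `Δ(G) ≥ 1`, then
`Γ⃗_LD(G) ≥ γ_LD(G) / (⌈log₂ Δ(G)⌉ + 1)`. -/
theorem stmt19 {V : Type*} [Fintype V] (G : SimpleGraph V)
    [DecidableRel G.Adj] (hΔ : 1 ≤ G.maxDegree) :
    (gammaLD G : ℝ) / ((⌈Real.logb 2 (G.maxDegree : ℝ)⌉ : ℝ) + 1)
      ≤ (upperDirLD G : ℝ) := by
  have hlog : ⌈Real.logb 2 (G.maxDegree : ℝ)⌉ = (Nat.clog 2 G.maxDegree : ℤ) := by
    have h := Real.ceil_logb_natCast (b := 2) (r := (G.maxDegree : ℝ)) (by positivity)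
    rw [Int.clog_natCast] at h
    exact_mod_cast h
  rw [hlog, Int.cast_natCast, div_le_iff₀ (by positivity), mul_comm]
  exact_mod_cast gammaLD_le_clog_maxDegree_mul G
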